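/- ∑_{n=1}^∞ h_n^{(2)}/n³ = 35·ζ(2)·ζ(3) - 62·ζ(5), where h_n^{(2)} = ∑_{k=1}^n 1/(k-1/2)². -/

import Mathlib

open scoped BigOperators

/-- ζ(p) = ∑_{n=1}^∞ 1/n^p -/
noncomputable def zetaR (p : ℕ) : ℝ := ∑' n : ℕ, 1 / ((n : ℝ) + 1) ^ p

/-- Odd harmonic number h_n^{(p)} = ∑_{k=1}^n 1/(k−1/2)^p -/
noncomputable def oddH (p n : ℕ) : ℝ := ∑ k ∈ Finset.range n, 1 / ((k : ℝ) + 1 / 2) ^ p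

/-- Alternating odd harmonic number h̄_n^{(p)} = ∑_{k=1}^n (−1)^{k−1}/(k−1/2)^p -/
noncomputable def altOddH (p n : ℕ) : ℝ :=
  ∑ k ∈ Finset.range n, (-1 : ℝ) ^ k / ((k : ℝ) + 1 / 2) ^ p

/-- Dirichlet beta β(s) = ∑_{n=0}^∞ (−1)^n/(2n+1)^s -/
noncomputable def betaD (s : ℕ) : ℝ := ∑' n : ℕ, (-1 : ℝ) ^ n / (2 * (n : ℝ) + 1) ^ s

open scoped NNReal ENNReal
noncomputable def Xr (n : ℕ) : ℝ≥0 := (n : ℝ≥0)⁻¹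
noncomputable def Xe (n : ℕ) : ℝ≥0∞ := (Xr n : ℝ≥0∞)

lemma Xr_pf (a b : ℕ) (ha : 0 < a) (hb : 0 < b) :
    Xr a * Xr b = Xr a * Xr (a+b) + Xr b * Xr (a+b) := by
  unfold Xr
  have : (a:ℝ≥0) ≠ 0 := by positivity
  have : (b:ℝ≥0) ≠ 0 := by positivity
  have : (a:ℝ≥0) + b ≠ 0 := by positivity
  push_cast
  field_simp
  try ring

lemma Xe_pf (a b : ℕ) (ha : 0 < a) (hb : 0 < b) :
    Xe a * Xe b = Xe a * Xe (a+b) + Xe b * Xe (a+b) := by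
  unfold Xe; exact_mod_cast Xr_pf a b ha hb

lemma Xe_pf23 (a b c : ℕ) (ha : 0 < a) (hb : 0 < b) (hc : c = a + b) :
    Xe a^2 * Xe b^3 = 3*(Xe a*Xe c^4) + Xe a^2*Xe c^3 + 3*(Xe b*Xe c^4) + 2*(Xe b^2*Xe c^3)
      + Xe b^3*Xe c^2 := by
  subst hc
  have h := Xr_pf a b ha hb
  unfold Xe
  norm_cast
  generalize Xr a = x at *
  generalize Xr b = y at *
  generalize Xr (a+b) = z at *
  rw [← NNReal.coe_inj] at h ⊢
  push_cast at h ⊢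
  generalize (x:ℝ) = x at *
  generalize (y:ℝ) = y at *
  generalize (z:ℝ) = z at *
  grind

lemma Xe_pf131 (a b c : ℕ) (ha : 0 < a) (hb : 0 < b) (hc : c = a + b) :
    Xe a * Xe b^3 * Xe c = Xe a*Xe c^4 + Xe b*Xe c^4 + Xe b^2*Xe c^3 + Xe b^3*Xe c^2 := by
  subst hc
  have h := Xr_pf a b ha hb
  unfold Xe
  norm_cast
  generalize Xr a = x at *
  generalize Xr b = y at *
  generalize Xr (a+b) = z at *
  rw [← NNReal.coe_inj] at h ⊢
  push_cast at h ⊢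
  generalize (x:ℝ) = x at *
  generalize (y:ℝ) = y at *
  generalize (z:ℝ) = z at *
  grind

lemma tsum_shift (f : ℕ → ℝ≥0∞) (i : ℕ) : ∑' d, f (i+d) = ∑' j, if i ≤ j then f j else 0 := by
  have := (add_right_injective i).tsum_eq (f := fun j => if i ≤ j then f j else 0) (by
    intro j hj
    simp at hj
    exact ⟨j - i, by simp; omega⟩)
  rw [← this]; simp

lemma tsum_le_swap (f : ℕ → ℕ → ℝ≥0∞) :
    ∑' i, ∑' d, f i (i+d) = ∑' n, ∑ i ∈ Finset.range (n+1), f i n := by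
  simp_rw [tsum_shift (f _)]
  rw [ENNReal.tsum_comm]
  congr 1; ext n
  rw [tsum_eq_sum (s := Finset.range (n+1))]
  · refine Finset.sum_congr rfl fun i hi => ?_
    simp at hi; simp; omega
  · intro i hi; simp at hi; simp; omega

lemma tsum_lt_swap (f : ℕ → ℕ → ℝ≥0∞) :
    ∑' i, ∑' d, f i (i+1+d) = ∑' n, ∑ i ∈ Finset.range n, f i n := by
  simp_rw [tsum_shift (f _)]
  rw [ENNReal.tsum_comm]
  congr 1; ext n
  rw [tsum_eq_sum (s := Finset.range n)]
  · refine Finset.sum_congr rfl fun i hi => ?_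
    simp at hi; simp; omega
  · intro i hi; simp at hi; simp; omega

lemma tsum_split (f : ℕ → ℕ → ℝ≥0∞) :
    ∑' i, ∑' j, f i j = ∑' i, ∑' d, f i (i+d) + ∑' j, ∑' d, f (j+1+d) j := by
  have h2 : ∑' j, ∑' d, f (j+1+d) j = ∑' i, ∑' j, if j + 1 ≤ i then f i j else 0 := by
    rw [ENNReal.tsum_comm (f := fun i j => if j + 1 ≤ i then f i j else 0)]
    congr 1; ext j
    exact tsum_shift (fun i => f i j) (j+1)
  rw [h2, ← ENNReal.tsum_add]
  congr 1; ext i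
  rw [tsum_shift (f i), ← ENNReal.tsum_add]
  congr 1; ext j
  by_cases h : i ≤ j
  · simp [h, show ¬ (j + 1 ≤ i) by omega]
  · simp [h, show (j + 1 ≤ i) by omega]

lemma tsum_evenodd (f : ℕ → ℝ≥0∞) : ∑' n, f n = ∑' n, f (2*n) + ∑' n, f (2*n+1) :=
  (tsum_even_add_odd ENNReal.summable ENNReal.summable).symm

lemma tele (b M : ℕ) : ∑ a ∈ Finset.range M, (b:ℝ) * (1/((a:ℝ)+1) * (1/((a:ℝ)+1+b))) =
   ∑ k ∈ Finset.range b, 1/((k:ℝ)+1) - ∑ k ∈ Finset.range b, 1/((M:ℝ)+k+1) := by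
  induction M with
  | zero => simp
  | succ M ih =>
    rw [Finset.sum_range_succ, ih]
    have h : ∑ k ∈ Finset.range b, 1/((M:ℝ)+k+1) - ∑ k ∈ Finset.range b, 1/(((M+1:ℕ):ℝ)+k+1) = 1/((M:ℝ)+1) - 1/((M:ℝ)+1+b) := by
      rw [← Finset.sum_sub_distrib]
      have := Finset.sum_range_sub' (G := ℝ) (fun k : ℕ => 1/((M:ℝ)+k+1)) b
      simp only [Nat.cast_add, Nat.cast_one, Nat.cast_zero, add_zero] at this ⊢
      rw [show (M:ℝ)+1+b = M + b + 1 by ring, ← this]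
      refine Finset.sum_congr rfl fun k _ => ?_
      congr 2; ring
    have h2 : (b:ℝ) * (1/((M:ℝ)+1) * (1/((M:ℝ)+1+b))) = 1/((M:ℝ)+1) - 1/((M:ℝ)+1+b) := by
      have : (M:ℝ)+1 ≠ 0 := by positivity
      have : (M:ℝ)+1+b ≠ 0 := by positivity
      field_simp; ring
    linarith

lemma tele_sum (b : ℕ) : HasSum (fun a : ℕ => (b:ℝ) * (1/((a:ℝ)+1) * (1/((a:ℝ)+1+b))))
    (∑ k ∈ Finset.range b, 1/((k:ℝ)+1)) := by
  rw [hasSum_iff_tendsto_nat_of_nonneg (fun a => by positivity)]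
  simp_rw [tele]
  have : Filter.Tendsto (fun M : ℕ => ∑ k ∈ Finset.range b, 1/((M:ℝ)+k+1)) Filter.atTop (nhds 0) := by
    rw [← Finset.sum_const_zero (M := ℝ) (s := Finset.range b)]
    refine tendsto_finsetSum _ fun k _ => ?_
    have := (tendsto_one_div_add_atTop_nhds_zero_nat (𝕜 := ℝ)).comp (Filter.tendsto_add_atTop_nat k)
    simpa [Function.comp_def] using this
  simpa using tendsto_const_nhds.sub this

lemma tele_nn (b : ℕ) : ∑' a, (b:ℝ≥0∞) * (Xe (a+1) * Xe (a+1+b)) = ∑ k ∈ Finset.range b, Xe (k+1) := by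
  have h : HasSum (fun a => (b:ℝ≥0) * (Xr (a+1) * Xr (a+1+b))) (∑ k ∈ Finset.range b, Xr (k+1)) := by
    rw [← NNReal.hasSum_coe]
    convert tele_sum b using 1 <;> simp [Xr]
  have := (ENNReal.hasSum_coe.2 h).tsum_eq
  simpa [Xe] using this

noncomputable def TT (p : ℕ) : ℝ≥0∞ := ∑' i, Xe (2*i+1)^p
noncomputable def ZZ (p : ℕ) : ℝ≥0∞ := ∑' i, Xe (2*i+2)^p
noncomputable def ee (p q : ℕ) : ℝ≥0∞ := ∑' i, ∑' j, Xe (2*i+1)^p * Xe (2*(i+j)+2)^q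
noncomputable def oo (p q : ℕ) : ℝ≥0∞ := ∑' i, ∑' j, Xe (2*i+1)^p * Xe (2*(i+j)+3)^q
noncomputable def gg (p q : ℕ) : ℝ≥0∞ := ∑' i, ∑' j, Xe (2*i+2)^p * Xe (2*(i+j)+3)^q

lemma prod_eq (f g : ℕ → ℝ≥0∞) : (∑' i, f i) * (∑' j, g j) = ∑' i, ∑' j, f i * g j := by
  simp_rw [ENNReal.tsum_mul_left, ENNReal.tsum_mul_right]

lemma ee_swap (p q : ℕ) : ∑' i, ∑' j, Xe (2*j+1)^p * Xe (2*(i+j)+2)^q = ee p q := by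
  rw [ENNReal.tsum_comm]; simp_rw [ee, add_comm]
lemma oo_swap (p q : ℕ) : ∑' i, ∑' j, Xe (2*j+1)^p * Xe (2*(i+j)+3)^q = oo p q := by
  rw [ENNReal.tsum_comm]; simp_rw [oo, add_comm]
lemma gg_swap (p q : ℕ) : ∑' i, ∑' j, Xe (2*j+2)^p * Xe (2*(i+j)+3)^q = gg p q := by
  rw [ENNReal.tsum_comm]; simp_rw [gg, add_comm]

lemma eqA : TT 2 * TT 3 = 6 * ee 1 4 + 3 * ee 2 3 + ee 3 2 := by
  have : TT 2 * TT 3 = 3 * ee 1 4 + ee 2 3 + 3 * ee 1 4 + 2 * ee 2 3 + ee 3 2 := by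
    rw [TT, TT, prod_eq]
    conv_rhs => rw [← ee_swap 3, ← ee_swap 2]; arg 1; arg 1; arg 2; rw [← ee_swap 1]
    conv_rhs => arg 1; arg 1; arg 1; arg 2; rw [ee_swap]
    simp only [ee, ← ENNReal.tsum_mul_left, ← ENNReal.tsum_add, pow_one]
    refine tsum_congr fun i => tsum_congr fun j => ?_
    exact Xe_pf23 _ _ _ (by omega) (by omega) (by ring)
  rw [this]; ring

lemma eqB : TT 2 * ZZ 3 = 3 * oo 1 4 + oo 2 3 + 3 * gg 1 4 + 2 * gg 2 3 + gg 3 2 := by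
  rw [TT, ZZ, prod_eq]
  simp only [← gg_swap]
  simp only [oo, ← ENNReal.tsum_mul_left, ← ENNReal.tsum_add, pow_one]
  refine tsum_congr fun i => tsum_congr fun j => ?_
  exact Xe_pf23 _ _ _ (by omega) (by omega) (by ring)

lemma eqC : ZZ 2 * TT 3 = 3 * gg 1 4 + gg 2 3 + 3 * oo 1 4 + 2 * oo 2 3 + oo 3 2 := by
  rw [TT, ZZ, prod_eq]
  simp only [← oo_swap]
  simp only [gg, ← ENNReal.tsum_mul_left, ← ENNReal.tsum_add, pow_one]
  refine tsum_congr fun i => tsum_congr fun j => ?_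
  exact Xe_pf23 _ _ _ (by omega) (by omega) (by ring)

lemma eqDE (p q : ℕ) : TT p * ZZ q = ee p q + gg q p := by
  rw [TT, ZZ, prod_eq, tsum_split, ee, gg]
  congr 1
  refine tsum_congr fun i => tsum_congr fun j => ?_
  rw [mul_comm]; congr 3; ring

lemma le_split (p q : ℕ) : ∑' i, ∑' d, Xe (2*i+1)^p * Xe (2*(i+d)+1)^q = TT (p+q) + oo p q := by
  rw [TT, oo, ← ENNReal.tsum_add]
  refine tsum_congr fun i => ?_
  rw [tsum_eq_zero_add' (f := fun d => Xe (2*i+1)^p * Xe (2*(i+d)+1)^q) ENNReal.summable]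
  simp only [add_zero, pow_add]
  rfl

lemma eqF : TT 2 * TT 3 = oo 2 3 + oo 3 2 + TT 5 := by
  rw [TT, TT, prod_eq, tsum_split, le_split]
  have : ∑' j, ∑' d, Xe (2*(j+1+d)+1)^2 * Xe (2*j+1)^3 = oo 3 2 := by
    rw [oo]
    refine tsum_congr fun i => tsum_congr fun j => ?_
    rw [mul_comm]; congr 3; ring
  rw [this]; ring

lemma harm_split (n : ℕ) : ∑ k ∈ Finset.range (2*n+1), Xe (k+1) =
    ∑ k ∈ Finset.range (n+1), Xe (2*k+1) + ∑ k ∈ Finset.range n, Xe (2*k+2) := by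
  induction n with
  | zero => simp
  | succ n ih =>
    rw [show 2*(n+1)+1 = 2*n+1+1+1 by ring, Finset.sum_range_succ, Finset.sum_range_succ, ih,
      Finset.sum_range_succ _ (n+1), Finset.sum_range_succ (fun k => Xe (2*k+2)) n]
    rw [show 2*(n+1)+1 = 2*n+1+1+1 by ring]
    ring

lemma eqG : 2 * ee 1 4 + ee 2 3 + ee 3 2 + (gg 1 4 + oo 1 4 + oo 2 3 + oo 3 2)
    = TT 5 + oo 1 4 + gg 1 4 := by
  have h1 : TT 5 + oo 1 4 + gg 1 4 = ∑' i, Xe (2*i+1)^4 * ∑ k ∈ Finset.range (2*i+1), Xe (k+1) := by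
    simp_rw [harm_split, mul_add, ENNReal.tsum_add, Finset.mul_sum]
    rw [← tsum_le_swap (fun k i => Xe (2*i+1)^4 * Xe (2*k+1)),
      ← tsum_lt_swap (fun k i => Xe (2*i+1)^4 * Xe (2*k+2)), show 5 = 1 + 4 by rfl, ← le_split]
    congr 1
    · refine tsum_congr fun i => tsum_congr fun j => ?_
      rw [mul_comm, pow_one]
    · rw [gg]
      refine tsum_congr fun i => tsum_congr fun j => ?_
      rw [mul_comm, pow_one]; congr 3; ring
  have h2 (i : ℕ) : Xe (2*i+1)^4 * ∑ k ∈ Finset.range (2*i+1), Xe (k+1) =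
      ∑' a, Xe (a+1) * Xe (2*i+1)^3 * Xe (a+1+(2*i+1)) := by
    rw [← tele_nn, ← ENNReal.tsum_mul_left]
    refine tsum_congr fun a => ?_
    have : Xe (2*i+1) * ((2*i+1 : ℕ) : ℝ≥0∞) = 1 := by
      unfold Xe Xr
      norm_cast
      exact inv_mul_cancel₀ (by positivity)
    calc _ = (Xe (2*i+1) * ((2*i+1 : ℕ) : ℝ≥0∞)) * (Xe (a+1) * Xe (2*i+1)^3 * Xe (a+1+(2*i+1))) := by ring
      _ = _ := by rw [this, one_mul]
  rw [h1]
  simp_rw [h2]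
  simp_rw [tsum_evenodd (fun a => Xe (a+1) * _ * _)]
  rw [ENNReal.tsum_add]
  congr 1
  · have : 2 * ee 1 4 + ee 2 3 + ee 3 2 = ee 1 4 + ee 1 4 + ee 2 3 + ee 3 2 := by ring
    rw [this]
    conv_lhs => arg 1; arg 1; arg 1; rw [← ee_swap 1]
    simp only [ee, ← ENNReal.tsum_add]
    refine tsum_congr fun i => tsum_congr fun j => ?_
    simp only [pow_one]
    rw [← Xe_pf131 (2*j+1) (2*i+1) (2*(i+j)+2) (by omega) (by omega) (by ring)]
    congr 2; ring
  · simp only [← gg_swap, oo, ← ENNReal.tsum_add]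
    refine tsum_congr fun i => tsum_congr fun j => ?_
    simp only [pow_one]
    rw [← Xe_pf131 (2*j+2) (2*i+1) (2*(i+j)+3) (by omega) (by omega) (by ring)]
    congr 2; ring

noncomputable def ZF (p : ℕ) : ℝ≥0∞ := ∑' i, Xe (i+1)^p

lemma ZF_real (p : ℕ) : (ZF p).toReal = zetaR p := by
  rw [ZF, ENNReal.tsum_toReal_eq (fun i => by simp [Xe]), zetaR]
  refine tsum_congr fun i => ?_
  simp only [Xe, Xr, ENNReal.toReal_pow, ENNReal.coe_toReal, NNReal.coe_inv]
  push_cast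
  simp

lemma ZF_fin (p : ℕ) (hp : 2 ≤ p) : ZF p ≠ ⊤ := by
  have h : Summable (fun i : ℕ => (Xr (i+1))^p) := by
    rw [← NNReal.summable_coe]
    have := (summable_nat_add_iff (f := fun n : ℕ => 1/(n:ℝ)^p) 1).2
      (Real.summable_one_div_nat_pow.2 (by omega))
    simpa [Xr] using this
  have := ENNReal.tsum_coe_ne_top_iff_summable.2 h
  simpa [ZF, Xe] using this

lemma ZF_split (p : ℕ) : ZF p = TT p + ZZ p := by
  rw [ZF, tsum_evenodd]; rfl

lemma ZZ_eq (p : ℕ) : ZZ p = Xe 2 ^ p * ZF p := by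
  rw [ZZ, ZF, ← ENNReal.tsum_mul_left]
  refine tsum_congr fun i => ?_
  rw [← mul_pow]
  congr 1
  unfold Xe Xr
  norm_cast
  rw [← mul_inv]; congr 1; push_cast; ring

lemma ZZ_real (p : ℕ) : (ZZ p).toReal = (1/2)^p * zetaR p := by
  rw [ZZ_eq, ENNReal.toReal_mul, ZF_real]
  simp [Xe, Xr]

lemma ZZ_fin (p : ℕ) (hp : 2 ≤ p) : ZZ p ≠ ⊤ := by
  have := ZF_fin p hp
  rw [ZF_split] at this
  exact (ENNReal.add_ne_top.1 this).2

lemma TT_fin (p : ℕ) (hp : 2 ≤ p) : TT p ≠ ⊤ := by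
  have := ZF_fin p hp
  rw [ZF_split] at this
  exact (ENNReal.add_ne_top.1 this).1

lemma TT_real (p : ℕ) (hp : 2 ≤ p) : (TT p).toReal = zetaR p - (1/2)^p * zetaR p := by
  rw [← ZZ_real, ← ZF_real, ZF_split, ENNReal.toReal_add (TT_fin p hp) (ZZ_fin p hp)]
  ring

lemma ee_real : ∑' n : ℕ, oddH 2 (n + 1) / ((n : ℝ) + 1) ^ 3 = 32 * (ee 2 3).toReal := by
  rw [ee, tsum_le_swap (fun i n => Xe (2*i+1)^2 * Xe (2*n+2)^3),
    ENNReal.tsum_toReal_eq (fun n => by simp [Xe, ENNReal.sum_eq_top, ENNReal.mul_eq_top]), ← tsum_mul_left]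
  refine tsum_congr fun n => ?_
  rw [ENNReal.toReal_sum (fun i _ => by simp [Xe, ENNReal.mul_eq_top]), oddH, Finset.sum_div, Finset.mul_sum]
  refine Finset.sum_congr rfl fun i _ => ?_
  simp only [Xe, Xr, ENNReal.toReal_mul, ENNReal.toReal_pow, ENNReal.coe_toReal, NNReal.coe_inv]
  push_cast
  have : (i:ℝ) + 1/2 ≠ 0 := by positivity
  have : 2*(i:ℝ) + 1 ≠ 0 := by positivity
  have : (n:ℝ) + 1 ≠ 0 := by positivity
  rw [show 2*(n:ℝ)+2 = 2*(n+1) by ring, show 2*(i:ℝ)+1 = 2*(i+1/2) by ring]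
  field_simp
  norm_num

lemma alg (T2 T3 T5 Z2 Z3 e1 e2 e3 o1 o2 o3 g1 g2 g3 : ℝ)
    (A : T2 * T3 = 6 * e1 + 3 * e2 + e3)
    (B : T2 * Z3 = 3 * o1 + o2 + 3 * g1 + 2 * g2 + g3)
    (C : Z2 * T3 = 3 * g1 + g2 + 3 * o1 + 2 * o2 + o3)
    (D : T2 * Z3 = e2 + g3) (E : T3 * Z2 = e3 + g2)
    (F : T2 * T3 = o2 + o3 + T5)
    (G : 2 * e1 + e2 + e3 + (g1 + o1 + o2 + o3) = T5 + o1 + g1) :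
    e2 = 2 * (T3 * Z2) + T2 * T3 - 2 * T5 := by
  rw [mul_comm Z2] at C
  linarith

lemma algE (T2 T3 T5 Z2 Z3 e1 e2 e3 o1 o2 o3 g1 g2 g3 : ℝ≥0∞)
    (hT2 : T2 ≠ ⊤) (hT3 : T3 ≠ ⊤) (hT5 : T5 ≠ ⊤) (hZ2 : Z2 ≠ ⊤) (hZ3 : Z3 ≠ ⊤)
    (A : T2 * T3 = 6 * e1 + 3 * e2 + e3)
    (B : T2 * Z3 = 3 * o1 + o2 + 3 * g1 + 2 * g2 + g3)
    (C : Z2 * T3 = 3 * g1 + g2 + 3 * o1 + 2 * o2 + o3)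
    (D : T2 * Z3 = e2 + g3) (E : T3 * Z2 = e3 + g2)
    (F : T2 * T3 = o2 + o3 + T5)
    (G : 2 * e1 + e2 + e3 + (g1 + o1 + o2 + o3) = T5 + o1 + g1) :
    e2.toReal = 2 * (T3.toReal * Z2.toReal) + T2.toReal * T3.toReal - 2 * T5.toReal := by
  have fA := ENNReal.mul_ne_top hT2 hT3
  have fB := ENNReal.mul_ne_top hT2 hZ3
  have fC := ENNReal.mul_ne_top hZ2 hT3
  rw [A] at fA
  rw [B] at fB
  rw [C] at fC
  have he1 : e1 ≠ ⊤ := by rintro rfl; simp at fA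
  have he2 : e2 ≠ ⊤ := by rintro rfl; simp at fA
  have he3 : e3 ≠ ⊤ := by rintro rfl; simp at fA
  have ho1 : o1 ≠ ⊤ := by rintro rfl; simp at fB
  have ho2 : o2 ≠ ⊤ := by rintro rfl; simp at fB
  have ho3 : o3 ≠ ⊤ := by rintro rfl; simp at fC
  have hg1 : g1 ≠ ⊤ := by rintro rfl; simp at fB
  have hg2 : g2 ≠ ⊤ := by rintro rfl; simp at fB
  have hg3 : g3 ≠ ⊤ := by rintro rfl; simp at fB
  lift T2 to ℝ≥0 using hT2
  lift T3 to ℝ≥0 using hT3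
  lift T5 to ℝ≥0 using hT5
  lift Z2 to ℝ≥0 using hZ2
  lift Z3 to ℝ≥0 using hZ3
  lift e1 to ℝ≥0 using he1
  lift e2 to ℝ≥0 using he2
  lift e3 to ℝ≥0 using he3
  lift o1 to ℝ≥0 using ho1
  lift o2 to ℝ≥0 using ho2
  lift o3 to ℝ≥0 using ho3
  lift g1 to ℝ≥0 using hg1
  lift g2 to ℝ≥0 using hg2
  lift g3 to ℝ≥0 using hg3
  simp only [ENNReal.coe_toReal]
  norm_cast at A B C D E F G
  exact alg T2 T3 T5 Z2 Z3 e1 e2 e3 o1 o2 o3 g1 g2 g3 (by exact_mod_cast A)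
    (by exact_mod_cast B) (by exact_mod_cast C) (by exact_mod_cast D) (by exact_mod_cast E)
    (by exact_mod_cast F) (by exact_mod_cast G)

/-- ∑_{n=1}^∞ h_n^{(2)}/n³ = 35ζ(2)ζ(3) − 62ζ(5) -/
theorem linear_S_sum_23 :
    (∑' n : ℕ, oddH 2 (n + 1) / ((n : ℝ) + 1) ^ 3) =
      35 * zetaR 2 * zetaR 3 - 62 * zetaR 5 := by
  have key := algE _ _ _ _ _ _ _ _ _ _ _ _ _ _ (TT_fin 2 (by norm_num)) (TT_fin 3 (by norm_num))
    (TT_fin 5 (by norm_num)) (ZZ_fin 2 (by norm_num)) (ZZ_fin 3 (by norm_num))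
    eqA eqB eqC (eqDE 2 3) (eqDE 3 2) eqF eqG
  rw [ee_real, key, TT_real 2 (by norm_num), TT_real 3 (by norm_num), TT_real 5 (by norm_num),
    ZZ_real 2]
  ring
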